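/- arXiv:2404.19033 — 4 statements merged into one kernel-verified Lean document; each statement's English description precedes it below -/
import Mathlib

section
/- The bilinear form ω on 𝔤₋₁ defined by ω(x,y) = κ(⁅x,y⁆, e) is skew-symmetric and nondegenerate: for every nonzero x ∈ 𝔤₋₁ there exists y ∈ 𝔤₋₁ with κ(⁅x,y⁆, e) ≠ 0. -/
namespace IsSl2Triple

open LieModule Module Module.End

variable {K L M : Type*} [Field K] [LieRing L] [LieAlgebra K L]
  [AddCommGroup M] [Module K M] [LieRingModule L M] [LieModule K L M]
  {h e f : L}

lemma lie_h_lie_e (t : IsSl2Triple h e f) (m : M) : ⁅h, ⁅e, m⁆⁆ = ⁅e, ⁅h, m⁆⁆ + 2 • ⁅e, m⁆ := by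
  rw [leibniz_lie, t.lie_h_e_nsmul, nsmul_lie, add_comm]

lemma lie_h_lie_f (t : IsSl2Triple h e f) (m : M) : ⁅h, ⁅f, m⁆⁆ = ⁅f, ⁅h, m⁆⁆ - 2 • ⁅f, m⁆ := by
  rw [leibniz_lie, t.lie_h_f_nsmul, neg_lie, nsmul_lie]
  abel

lemma lie_e_lie_f (t : IsSl2Triple h e f) (m : M) : ⁅e, ⁅f, m⁆⁆ = ⁅f, ⁅e, m⁆⁆ + ⁅h, m⁆ := by
  rw [leibniz_lie, t.lie_e_f, add_comm]

variable (K M) in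
/-- The Casimir operator `(h + 1)² + 4 f e` of an `sl₂`-triple acting on a Lie module, normalised so
that a primitive vector of weight `n` has eigenvalue `(n + 1)²`. -/
def casimir (_ : IsSl2Triple h e f) : End K M :=
  (toEnd K L M h + 1) ^ 2 + 4 • (toEnd K L M f * toEnd K L M e)

lemma casimir_apply (t : IsSl2Triple h e f) (m : M) :
    t.casimir K M m = ⁅h, ⁅h, m⁆⁆ + 2 • ⁅h, m⁆ + m + 4 • ⁅f, ⁅e, m⁆⁆ := by
  simp only [casimir, pow_two, LinearMap.add_apply, Module.End.mul_apply, toEnd_apply_apply,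
    Module.End.one_apply, LinearMap.smul_apply, lie_add]
  module

lemma casimir_symm (t : IsSl2Triple h e f) : t.symm.casimir K M = t.casimir K M := by
  ext m
  simp only [casimir_apply, neg_lie, lie_neg, t.lie_e_lie_f]
  module

lemma commute_casimir_e (t : IsSl2Triple h e f) : Commute (t.casimir K M) (toEnd K L M e) := by
  ext m
  simp only [Module.End.mul_apply, toEnd_apply_apply, casimir_apply, lie_add, lie_nsmul,
    t.lie_h_lie_e, t.lie_e_lie_f]
  module

lemma commute_casimir_f (t : IsSl2Triple h e f) : Commute (t.casimir K M) (toEnd K L M f) := by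
  rw [← t.casimir_symm]
  exact t.symm.commute_casimir_e

lemma commute_casimir_h (t : IsSl2Triple h e f) : Commute (t.casimir K M) (toEnd K L M h) := by
  ext m
  simp only [Module.End.mul_apply, toEnd_apply_apply, casimir_apply, lie_add, lie_nsmul,
    t.lie_h_lie_e, t.lie_h_lie_f]
  module

lemma HasPrimitiveVectorWith.casimir_apply {t : IsSl2Triple h e f} {m : M} {μ : K}
    (P : HasPrimitiveVectorWith t m μ) : t.casimir K M m = (μ + 1) ^ 2 • m := by
  rw [IsSl2Triple.casimir_apply, P.lie_e, P.lie_h, lie_smul, P.lie_h, lie_zero]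
  module

lemma HasPrimitiveVectorWith.eq_of_mem_maxGenEigenspace_casimir {t : IsSl2Triple h e f} {m : M}
    {μ c : K} (P : HasPrimitiveVectorWith t m μ) (hm : m ∈ (t.casimir K M).maxGenEigenspace c) :
    c = (μ + 1) ^ 2 := by
  by_contra hc
  refine P.ne_zero <| Submodule.disjoint_def.mp
    ((t.casimir K M).disjoint_genEigenspace hc ⊤ ⊤) m hm ?_
  exact eigenspace_le_maxGenEigenspace (mem_eigenspace_iff.mpr P.casimir_apply)

lemma lie_h_pow_toEnd_f_of_lie_h_eq_add (t : IsSl2Triple h e f) {p q : M} {μ : K}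
    (hq : ⁅h, q⁆ = μ • q + p) (k : ℕ) :
    ⁅h, (toEnd K L M f ^ k) q⁆
      = (μ - 2 * k) • (toEnd K L M f ^ k) q + (toEnd K L M f ^ k) p := by
  induction k with
  | zero => simpa using hq
  | succ k ih =>
    simp only [pow_succ', Module.End.mul_apply, toEnd_apply_apply] at ih ⊢
    rw [t.lie_h_lie_f, ih, lie_add, lie_smul]
    push_cast
    module

lemma lie_h_pow_toEnd_e_of_lie_h_eq_add (t : IsSl2Triple h e f) {p q : M} {μ : K}
    (hq : ⁅h, q⁆ = μ • q + p) (k : ℕ) :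
    ⁅h, (toEnd K L M e ^ k) q⁆
      = (μ + 2 * k) • (toEnd K L M e ^ k) q + (toEnd K L M e ^ k) p := by
  induction k with
  | zero => simpa using hq
  | succ k ih =>
    simp only [pow_succ', Module.End.mul_apply, toEnd_apply_apply] at ih ⊢
    rw [t.lie_h_lie_e, ih, lie_add, lie_smul]
    push_cast
    module

lemma lie_e_pow_succ_toEnd_f_of_lie_h_eq_add (t : IsSl2Triple h e f) {p q : M} {μ : K}
    (hq : ⁅h, q⁆ = μ • q + p) (he : ⁅e, q⁆ = 0) (k : ℕ) :
    ⁅e, (toEnd K L M f ^ (k + 1)) q⁆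
      = ((k + 1) * (μ - k)) • (toEnd K L M f ^ k) q + (k + 1 : K) • (toEnd K L M f ^ k) p := by
  induction k with
  | zero => simp [t.lie_e_lie_f, he, hq]
  | succ k ih =>
    rw [pow_succ', Module.End.mul_apply, toEnd_apply_apply, t.lie_e_lie_f, ih,
      t.lie_h_pow_toEnd_f_of_lie_h_eq_add hq, lie_add, lie_smul, lie_smul]
    simp only [pow_succ', Module.End.mul_apply, toEnd_apply_apply]
    push_cast
    module

section CharZero

variable [CharZero K] [FiniteDimensional K M]

lemma exists_pow_toEnd_e_eq_zero (t : IsSl2Triple h e f) {m : M} {μ : K} (hm : ⁅h, m⁆ = μ • m) :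
    ∃ k, (toEnd K L M e ^ k) m = 0 := by
  by_contra! contra
  have h_inj : Function.Injective fun n : ℕ ↦ μ + 2 * (n : K) := fun a b hab ↦ by simpa using hab
  have := (toEnd K L M h).eigenvectors_linearIndependent' _ h_inj
    (fun n ↦ (toEnd K L M e ^ n) m) fun n ↦
      ⟨mem_eigenspace_iff.mpr (t.lie_h_pow_toEnd_e hm n), contra n⟩
  have := this.finite
  exact not_finite ℕ

lemma exists_nat_hasPrimitiveVectorWith (t : IsSl2Triple h e f) {m : M} {μ : K} (hm₀ : m ≠ 0)
    (hm : ⁅h, m⁆ = μ • m) :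
    ∃ i n : ℕ, μ + 2 * i = n ∧ HasPrimitiveVectorWith t ((toEnd K L M e ^ i) m) (n : K) := by
  obtain ⟨i, hi, hi'⟩ := Nat.exists_not_and_succ_of_not_zero_of_exists
    (p := fun k ↦ (toEnd K L M e ^ k) m = 0) hm₀ (t.exists_pow_toEnd_e_eq_zero hm)
  have P : HasPrimitiveVectorWith t ((toEnd K L M e ^ i) m) (μ + 2 * i) :=
    ⟨hi, t.lie_h_pow_toEnd_e hm i, by rwa [lie_e_pow_toEnd_e]⟩
  obtain ⟨n, hn⟩ := P.exists_nat
  exact ⟨i, n, hn, hn ▸ P⟩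

lemma exists_nat_of_mem_maxGenEigenspace_casimir (t : IsSl2Triple h e f) {m : M} {μ c : K}
    (hm₀ : m ≠ 0) (hm : ⁅h, m⁆ = μ • m) (hc : m ∈ (t.casimir K M).maxGenEigenspace c) :
    ∃ i n : ℕ, μ + 2 * i = n ∧ c = (n + 1) ^ 2 := by
  obtain ⟨i, n, hn, P⟩ := t.exists_nat_hasPrimitiveVectorWith hm₀ hm
  exact ⟨i, n, hn, P.eq_of_mem_maxGenEigenspace_casimir <|
    mapsTo_maxGenEigenspace_of_comm (t.commute_casimir_e.pow_right i) c hc⟩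

/-- In a generalized eigenspace of the Casimir operator containing a primitive vector of weight `n`,
all weights are at most `n`. -/
lemma HasPrimitiveVectorWith.eq_zero_of_mem_maxGenEigenspace_casimir {t : IsSl2Triple h e f}
    {p m : M} {n : ℕ} {c : K} (P : HasPrimitiveVectorWith t p (n : K))
    (hp : p ∈ (t.casimir K M).maxGenEigenspace c) (hm : ⁅h, m⁆ = (n + 2 : K) • m)
    (hc : m ∈ (t.casimir K M).maxGenEigenspace c) : m = 0 := by
  by_contra hm₀
  obtain ⟨i, k, hk, hck⟩ := t.exists_nat_of_mem_maxGenEigenspace_casimir hm₀ hm hc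
  rw [P.eq_of_mem_maxGenEigenspace_casimir hp] at hck
  norm_cast at hk hck
  have := Nat.pow_left_injective (n := 2) (by simp) hck
  lia

/-- In a generalized eigenspace of the Casimir operator containing a primitive vector of weight `n`,
all weights are at least `-n`. -/
lemma HasPrimitiveVectorWith.eq_zero_of_mem_maxGenEigenspace_casimir' {t : IsSl2Triple h e f}
    {p m : M} {n : ℕ} {c : K} (P : HasPrimitiveVectorWith t p (n : K))
    (hp : p ∈ (t.casimir K M).maxGenEigenspace c) (hm : ⁅h, m⁆ = (-n - 2 : K) • m)
    (hc : m ∈ (t.casimir K M).maxGenEigenspace c) : m = 0 := by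
  by_contra hm₀
  have hm' : ⁅-h, m⁆ = (n + 2 : K) • m := by rw [neg_lie, hm]; module
  obtain ⟨i, k, hk, hck⟩ := t.symm.exists_nat_of_mem_maxGenEigenspace_casimir (c := c) hm₀ hm'
    (by rwa [casimir_symm])
  rw [P.eq_of_mem_maxGenEigenspace_casimir hp] at hck
  norm_cast at hk hck
  have := Nat.pow_left_injective (n := 2) (by simp) hck
  lia

/-- The element `h` of an `sl₂`-triple has no nontrivial Jordan block within a generalized
eigenspace of the Casimir operator. -/
lemma eq_zero_of_lie_h_eq_add_of_mem (t : IsSl2Triple h e f) {v w : M} {μ c : K}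
    (hv : ⁅h, v⁆ = μ • v + w) (hw : ⁅h, w⁆ = μ • w)
    (hc : v ∈ (t.casimir K M).maxGenEigenspace c) : w = 0 := by
  by_contra hw₀
  have hcw : w ∈ (t.casimir K M).maxGenEigenspace c := by
    rw [← sub_eq_iff_eq_add'.mpr hv]
    exact sub_mem (mapsTo_maxGenEigenspace_of_comm t.commute_casimir_h c hc)
      (Submodule.smul_mem _ _ hc)
  obtain ⟨i, n, hn, P⟩ := t.exists_nat_hasPrimitiveVectorWith hw₀ hw
  have hcE (k : ℕ) {x : M} (hx : x ∈ (t.casimir K M).maxGenEigenspace c) :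
      (toEnd K L M e ^ k) x ∈ (t.casimir K M).maxGenEigenspace c :=
    mapsTo_maxGenEigenspace_of_comm (t.commute_casimir_e.pow_right k) c hx
  have hq := t.lie_h_pow_toEnd_e_of_lie_h_eq_add hv i
  have hq' := hcE i hc
  have hp' := hcE i hcw
  rw [hn] at hq
  set q := (toEnd K L M e ^ i) v
  set p := (toEnd K L M e ^ i) w
  have heq : ⁅e, q⁆ = 0 := by
    refine P.eq_zero_of_mem_maxGenEigenspace_casimir hp' ?_ (by simpa using hcE 1 hq')
    rw [t.lie_h_lie_e, hq, lie_add, P.lie_e, lie_smul]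
    module
  have hz : (toEnd K L M f ^ (n + 1)) q = 0 := by
    refine P.eq_zero_of_mem_maxGenEigenspace_casimir' hp' ?_
      (mapsTo_maxGenEigenspace_of_comm (t.commute_casimir_f.pow_right _) c hq')
    rw [t.lie_h_pow_toEnd_f_of_lie_h_eq_add hq, P.pow_toEnd_f_eq_zero_of_eq_nat rfl]
    push_cast
    module
  have := t.lie_e_pow_succ_toEnd_f_of_lie_h_eq_add hq heq n
  rw [hz, lie_zero, sub_self, mul_zero, zero_smul, zero_add, eq_comm, smul_eq_zero] at this
  exact this.elim (Nat.cast_add_one_ne_zero n) (P.pow_toEnd_f_ne_zero_of_eq_nat rfl le_rfl)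

/-- The element `h` of an `sl₂`-triple has no nontrivial Jordan block on a finite-dimensional
module over an algebraically closed field of characteristic zero. -/
lemma eq_zero_of_lie_h_eq_add [IsAlgClosed K] (t : IsSl2Triple h e f) {v w : M} {μ : K}
    (hv : ⁅h, v⁆ = μ • v + w) (hw : ⁅h, w⁆ = μ • w) : w = 0 := by
  obtain ⟨T, hT, hCT⟩ : ∃ T : End K M, (∀ x, T x = ⁅h, x⁆ - μ • x) ∧
      Commute (t.casimir K M) (T ^ 2) := by
    refine ⟨toEnd K L M h - μ • 1, fun x ↦ by simp, Commute.pow_right ?_ 2⟩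
    exact t.commute_casimir_h.sub_right ((Commute.one_right _).smul_right μ)
  let X : Submodule K M := LinearMap.ker (T ^ 2)
  have hX : Set.MapsTo (t.casimir K M) X X := fun x hx ↦ by
    simp only [X, SetLike.mem_coe, LinearMap.mem_ker] at hx ⊢
    rw [← Module.End.mul_apply, ← hCT.eq, Module.End.mul_apply, hx, map_zero]
  suffices X ≤ LinearMap.ker T by
    have hvX : v ∈ X := by simp [X, pow_two, hT, hv, hw]
    simpa [hT, hv] using this hvX
  have hX_eq : X = ⨆ c, X ⊓ (t.casimir K M).maxGenEigenspace c := by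
    have := Submodule.inf_iSup_genEigenspace hX ⊤
    rwa [iSup_maxGenEigenspace_eq_top, inf_top_eq] at this
  rw [hX_eq]
  refine iSup_le fun c x ⟨hxX, hxc⟩ ↦ ?_
  have hx₂ : T (T x) = 0 := by
    rw [← Module.End.mul_apply, ← pow_two]
    exact hxX
  rw [hT (T x), sub_eq_zero] at hx₂
  rw [LinearMap.mem_ker]
  exact t.eq_zero_of_lie_h_eq_add_of_mem (v := x) (by rw [hT]; module) hx₂ hxc

end CharZero

end IsSl2Triple

/-- Let `𝔤` be a finite-dimensional semisimple complex Lie algebra with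
Killing form `κ`, and `(e, h, f)` an `𝔰𝔩₂`-triple with `e ≠ 0`.  The bilinear form
`ω(x, y) = κ(⁅x, y⁆, e)` on the `ad h`-eigenspace `𝔤₋₁` is skew-symmetric and nondegenerate. -/
theorem stmt0 {L : Type*} [LieRing L] [LieAlgebra ℂ L]
    [Module.Finite ℂ L] [LieAlgebra.IsSemisimple ℂ L]
    (e h f : L) (he : e ≠ 0)
    (hhe : ⁅h, e⁆ = (2 : ℂ) • e) (hhf : ⁅h, f⁆ = (-2 : ℂ) • f) (hef : ⁅e, f⁆ = h) :
    (∀ x y : L, ⁅h, x⁆ = (-1 : ℂ) • x → ⁅h, y⁆ = (-1 : ℂ) • y →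
      killingForm ℂ L ⁅x, y⁆ e = - killingForm ℂ L ⁅y, x⁆ e) ∧
    (∀ x : L, ⁅h, x⁆ = (-1 : ℂ) • x → x ≠ 0 →
      ∃ y : L, ⁅h, y⁆ = (-1 : ℂ) • y ∧ killingForm ℂ L ⁅x, y⁆ e ≠ 0) := by
  have hinv (x y z : L) : killingForm ℂ L ⁅x, y⁆ z = killingForm ℂ L x ⁅y, z⁆ :=
    LieModule.traceForm_apply_lie_apply ℂ L L x y z
  have t : IsSl2Triple h e f :=
    { h_ne_zero := by
        rintro rfl
        exact he (by simpa using hhe.symm)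
      lie_e_f := hef
      lie_h_e_nsmul := by rw [hhe]; module
      lie_h_f_nsmul := by rw [hhf]; module }
  refine ⟨fun x y _ _ ↦ by rw [← lie_skew, map_neg, LinearMap.neg_apply], fun x hx hx₀ ↦ ?_⟩
  by_contra! hω
  have hu : ⁅h, ⁅e, x⁆⁆ = ⁅e, x⁆ := by
    rw [t.lie_h_lie_e, hx, lie_smul]
    module
  have hex : ⁅e, x⁆ = 0 := by
    refine (LieAlgebra.IsKilling.killingForm_nondegenerate ℂ L).2 _ fun z ↦ ?_
    let T : Module.End ℂ L := LieAlgebra.ad ℂ L h + 1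
    have hT (a : L) : T a = ⁅h, a⁆ + a := rfl
    have hdisj : Disjoint (LinearMap.range T) (LinearMap.ker T) := by
      rw [Submodule.disjoint_def]
      rintro _ ⟨a, rfl⟩ ha
      refine t.eq_zero_of_lie_h_eq_add (v := a) (μ := (-1 : ℂ)) (by rw [hT]; module) ?_
      rw [LinearMap.mem_ker, hT (T a)] at ha
      rw [eq_neg_of_add_eq_zero_left ha]
      module
    have htop := Submodule.eq_top_of_disjoint _ _ T.finrank_range_add_finrank_ker.ge hdisj
    obtain ⟨_, ⟨a, rfl⟩, b, hb, rfl⟩ := Submodule.mem_sup.mp (htop ▸ Submodule.mem_top (x := z))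
    have hb' : ⁅h, b⁆ = (-1 : ℂ) • b := by
      rw [LinearMap.mem_ker, hT] at hb
      rw [eq_neg_of_add_eq_zero_left hb]
      module
    have hTa : killingForm ℂ L (T a) ⁅e, x⁆ = 0 := by
      rw [hT, ← lie_skew, map_add, map_neg, LinearMap.add_apply, LinearMap.neg_apply, hinv, hu,
        neg_add_cancel]
    have hbx : killingForm ℂ L b ⁅e, x⁆ = 0 := by
      have := hω b hb'
      rwa [← lie_skew, map_neg, LinearMap.neg_apply, hinv, ← lie_skew, map_neg, neg_neg] at this
    rw [map_add, LinearMap.add_apply, hTa, hbx, add_zero]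
  have P : IsSl2Triple.HasPrimitiveVectorWith t x (-1 : ℂ) := ⟨hx₀, hx, hex⟩
  obtain ⟨n, hn⟩ := P.exists_nat
  exact Nat.cast_add_one_ne_zero (R := ℂ) n (by rw [← hn]; ring)
end

section
/- 𝔪_l^⊥ = ⁅𝔫_l, e⁆ ⊕ ker ad(f): the κ-orthogonal complement of 𝔪_l in 𝔤 equals the sum of the subspace {⁅x,e⁆ : x ∈ 𝔫_l} and ker ad(f), and these two subspaces intersect trivially. -/
open LieAlgebra

variable {L : Type*} [LieRing L] [LieAlgebra ℂ L]

/-- The eigenspace `𝔤ᵢ` of `ad h` with eigenvalue `i ∈ ℤ`. -/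
noncomputable def gEig (h : L) (i : ℤ) : Submodule ℂ L :=
  Module.End.eigenspace ((ad ℂ L h)) (i : ℂ)

/-- `𝔤_{≤k}`, the sum of the eigenspaces `𝔤ᵢ` for `i ≤ k`. -/
noncomputable def gLe (h : L) (k : ℤ) : Submodule ℂ L :=
  ⨆ i ∈ Set.Iic k, gEig h i

/-- `l^{⊥ω} = {y ∈ 𝔤₋₁ : ω(x, y) = 0 for all x ∈ l}`, where `ω(x, y) = κ(⁅x, y⁆, e)`. -/
noncomputable def lPerpOmega (e h : L) (l : Submodule ℂ L) : Submodule ℂ L :=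
  gEig h (-1) ⊓
    ⨅ x ∈ l, LinearMap.ker (((killingForm ℂ L).flip e).comp (ad ℂ L x))

/-- `𝔫_l = l + 𝔤_{≤ -2}`. -/
noncomputable def nSub (h : L) (l : Submodule ℂ L) : Submodule ℂ L :=
  l ⊔ gLe h (-2)

/-- `𝔪_l = l^{⊥ω} + 𝔤_{≤ -2}`. -/
noncomputable def mSub (e h : L) (l : Submodule ℂ L) : Submodule ℂ L :=
  lPerpOmega e h l ⊔ gLe h (-2)

/-- The `κ`-orthogonal complement of `𝔪_l` in `𝔤`. -/
noncomputable def mPerp (e h : L) (l : Submodule ℂ L) : Submodule ℂ L :=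
  ⨅ z ∈ mSub e h l, LinearMap.ker ((killingForm ℂ L).flip z)

/-- The subspace `⁅𝔫_l, e⁆ = {⁅x, e⁆ : x ∈ 𝔫_l}`. -/
noncomputable def brackNlE (e h : L) (l : Submodule ℂ L) : Submodule ℂ L :=
  Submodule.map (-(ad ℂ L e)) (nSub h l)

namespace IsSl2Triple

open LieModule Module

section Representation

variable {K L M : Type*} [Field K] [CharZero K] [LieRing L] [LieAlgebra K L]
  [AddCommGroup M] [Module K M] [LieRingModule L M] [LieModule K L M]
  {h e f : L}

lemma lie_h_toEnd_f_pow (t : IsSl2Triple h e f) (n : ℕ) (v : M) :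
    ⁅h, (toEnd K L M f ^ n) v⁆ = (toEnd K L M f ^ n) (⁅h, v⁆ - (2 * n : K) • v) := by
  induction n with
  | zero => simp
  | succ n ih =>
    rw [pow_succ', Module.End.mul_apply, toEnd_apply_apply, leibniz_lie h, t.lie_lie_smul_f K, ih]
    simp only [Module.End.mul_apply, toEnd_apply_apply, map_sub, map_smul, neg_lie, smul_lie,
      lie_sub, lie_smul]
    push_cast
    module

lemma lie_e_toEnd_f_pow_succ (t : IsSl2Triple h e f) (n : ℕ) (v : M) :
    ⁅e, (toEnd K L M f ^ (n + 1)) v⁆ = (toEnd K L M f ^ (n + 1)) ⁅e, v⁆ +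
      (n + 1 : K) • (toEnd K L M f ^ n) (⁅h, v⁆ - (n : K) • v) := by
  induction n with
  | zero => simp [leibniz_lie e f v, t.lie_e_f, add_comm]
  | succ n ih =>
    rw [pow_succ', Module.End.mul_apply, toEnd_apply_apply, leibniz_lie e, t.lie_e_f, ih,
      t.lie_h_toEnd_f_pow]
    simp only [pow_succ', Module.End.mul_apply, toEnd_apply_apply, map_sub, map_smul,
      lie_add, lie_sub, lie_smul]
    push_cast
    module

variable [FiniteDimensional K M]

variable (K M) in
lemma isNilpotent_toEnd_f (t : IsSl2Triple h e f) : IsNilpotent (toEnd K L M f) := by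
  by_contra hf
  have hne (n : ℕ) : toEnd K L M f ^ n ≠ 0 := fun h0 ↦ hf ⟨n, h0⟩
  let T : End K (End K M) :=
    LinearMap.mulLeft K (toEnd K L M h) - LinearMap.mulRight K (toEnd K L M h)
  have hT (n : ℕ) : T.HasEigenvalue (-(2 * n : K)) := by
    refine Module.End.hasEigenvalue_of_hasEigenvector (x := toEnd K L M f ^ n)
      ⟨Module.End.mem_eigenspace_iff.mpr ?_, hne n⟩
    ext v
    have := t.lie_h_toEnd_f_pow (K := K) n v
    simp [T, this]
  have hinj : Function.Injective fun n : ℕ ↦ -(2 * n : K) := fun a b hab ↦ by simpa using hab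
  exact Set.infinite_range_of_injective hinj <|
    (Module.End.finite_hasEigenvalue T).subset (by rintro _ ⟨n, rfl⟩; exact hT n)

lemma eq_zero_of_lie_f_lie_e_eq_zero (t : IsSl2Triple h e f) {v : M} {μ : K}
    (hv : ⁅h, v⁆ = μ • v) (hμ : ∀ n : ℕ, μ ≠ n) (hfe : ⁅f, ⁅e, v⁆⁆ = 0) : v = 0 := by
  suffices ∀ n : ℕ, (toEnd K L M f ^ n) v = 0 → v = 0 by
    obtain ⟨n, hn⟩ := t.isNilpotent_toEnd_f K M
    exact this n (by simp [hn])
  intro n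
  induction n with
  | zero => simp
  | succ n ih =>
    intro hn
    have key := t.lie_e_toEnd_f_pow_succ (K := K) n v
    rw [hn, pow_succ, Module.End.mul_apply, toEnd_apply_apply, hfe, hv, ← sub_smul] at key
    have h1 : (n + 1 : K) ≠ 0 := by exact_mod_cast n.succ_ne_zero
    have h2 : μ - n ≠ 0 := sub_ne_zero.mpr (hμ n)
    apply ih
    simpa [h1, h2] using key.symm

lemma ker_toEnd_e_le_iSup_eigenspace (t : IsSl2Triple h e f) :
    LinearMap.ker (toEnd K L M e) ≤ ⨆ j : ℕ, (toEnd K L M h).eigenspace (j : K) := by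
  suffices ∀ (n : ℕ) (v : M), ⁅e, v⁆ = 0 → (toEnd K L M f ^ n) v = 0 →
      v ∈ ⨆ j ∈ Finset.range n, (toEnd K L M h).eigenspace (j : K) by
    obtain ⟨n, hn⟩ := t.isNilpotent_toEnd_f K M
    intro v hv
    have hle : (⨆ j ∈ Finset.range n, (toEnd K L M h).eigenspace (j : K)) ≤
        ⨆ j : ℕ, (toEnd K L M h).eigenspace (j : K) :=
      iSup_mono fun j ↦ iSup_le fun _ ↦ le_rfl
    exact hle (this n v hv (by simp [hn]))
  intro n
  induction n with
  | zero => intro v _ hv; simpa using hv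
  | succ n ih =>
    intro v hev hfv
    have key := t.lie_e_toEnd_f_pow_succ (K := K) n v
    have h1 : (n + 1 : K) ≠ 0 := by exact_mod_cast n.succ_ne_zero
    have hz : (toEnd K L M f ^ n) (⁅h, v⁆ - (n : K) • v) = 0 := by
      simpa [hfv, hev, h1] using key.symm
    have heh : ⁅e, ⁅h, v⁆ - (n : K) • v⁆ = 0 := by
      rw [lie_sub, leibniz_lie e h, hev, ← lie_skew, t.lie_h_e_smul K]
      simp [hev]
    have hmem := ih _ heh hz
    have hle : (⨆ j ∈ Finset.range n, (toEnd K L M h).eigenspace (j : K)) ≤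
        (⨆ j ∈ Finset.range n, (toEnd K L M h).eigenspace (j : K)).map
          (toEnd K L M h - (n : K) • (1 : End K M)) := by
      refine iSup₂_le fun j hj x hx ↦ ?_
      have hjn : (j : K) - n ≠ 0 :=
        sub_ne_zero.mpr (by exact_mod_cast (Finset.mem_range.mp hj).ne)
      refine ⟨((j : K) - n)⁻¹ • x, Submodule.smul_mem _ _
        (Submodule.mem_iSup_of_mem j (Submodule.mem_iSup_of_mem hj hx)), ?_⟩
      rw [Module.End.mem_eigenspace_iff] at hx
      simp only [map_smul, LinearMap.sub_apply, hx, LinearMap.smul_apply, Module.End.one_apply, ← sub_smul]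
      rw [smul_smul, inv_mul_cancel₀ hjn, one_smul]
    obtain ⟨w, hw, hwv⟩ := hle hmem
    rw [Finset.range_add_one, Finset.iSup_insert, ← sub_add_cancel v w]
    refine Submodule.add_mem_sup ?_ hw
    rw [Module.End.mem_eigenspace_iff, map_sub, smul_sub, sub_eq_sub_iff_sub_eq_sub]
    simpa using hwv.symm

variable [IsAlgClosed K]

lemma range_toEnd_e_inf_ker_toEnd_f (t : IsSl2Triple h e f) :
    LinearMap.range (toEnd K L M e) ⊓ LinearMap.ker (toEnd K L M f) = ⊥ := by
  set U := LinearMap.range (toEnd K L M e) ⊓ LinearMap.ker (toEnd K L M f)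
  by_contra hne
  have hstab : ∀ u ∈ U, toEnd K L M h u ∈ U := by
    rintro _ ⟨⟨v, rfl⟩, hv⟩
    simp only [SetLike.mem_coe, LinearMap.mem_ker, toEnd_apply_apply] at hv
    refine ⟨⟨⁅h, v⁆ + (2 : K) • v, ?_⟩, ?_⟩
    · simp [leibniz_lie h e v, t.lie_h_e_smul K, add_comm]
    · simp only [SetLike.mem_coe, LinearMap.mem_ker, toEnd_apply_apply]
      rw [leibniz_lie f h, hv, ← lie_skew, t.lie_lie_smul_f K]
      simp [hv]
  have : Nontrivial U := Submodule.nontrivial_iff_ne_bot.mpr hne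
  obtain ⟨μ, hμ⟩ := Module.End.exists_eigenvalue ((toEnd K L M h).restrict hstab)
  obtain ⟨⟨u, huU⟩, hu⟩ := hμ.exists_hasEigenvector
  have hu0 : u ≠ 0 := fun h0 ↦ hu.2 (by ext; exact h0)
  have hhu : ⁅h, u⁆ = μ • u := congrArg Subtype.val hu.apply_eq_smul
  obtain ⟨⟨v, hv⟩, hfu⟩ := huU
  simp only [SetLike.mem_coe, LinearMap.mem_ker, toEnd_apply_apply] at hv hfu
  obtain ⟨j, hj⟩ := (show t.symm.HasPrimitiveVectorWith u (-μ) from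
    ⟨hu0, by simp [hhu], hfu⟩).exists_nat
  obtain rfl : μ = -j := by rw [← hj, neg_neg]
  have hnat (n : ℕ) : (-(j : K) - 2) ≠ n := by
    intro hn
    have : (n + j + 2 : K) = 0 := by linear_combination -hn
    exact absurd (by exact_mod_cast this) (Nat.succ_ne_zero (n + j + 1))
  have hker : ∀ z ∈ LinearMap.ker (toEnd K L M e),
      (toEnd K L M h - (-(j : K) - 2) • (1 : End K M)) z ∈ LinearMap.ker (toEnd K L M e) := by
    intro z hz
    simp only [LinearMap.mem_ker, toEnd_apply_apply, LinearMap.sub_apply,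
      LinearMap.smul_apply, Module.End.one_apply] at hz ⊢
    rw [lie_sub, leibniz_lie e h, hz, ← lie_skew, t.lie_h_e_smul K]
    simp [hz]
  have hsurj : Function.Surjective
      ((toEnd K L M h - (-(j : K) - 2) • (1 : End K M)).restrict hker) := by
    rw [← LinearMap.injective_iff_surjective, ← LinearMap.ker_eq_bot, LinearMap.ker_eq_bot']
    rintro ⟨z, hz⟩ hz0
    have hz1 : ⁅h, z⁆ = (-(j : K) - 2) • z := by
      simpa [sub_eq_zero] using congrArg Subtype.val hz0
    by_contra hne
    obtain ⟨n, hn⟩ := (show t.HasPrimitiveVectorWith z (-(j : K) - 2) from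
      ⟨fun h0 ↦ hne (by ext; exact h0), hz1, hz⟩).exists_nat
    exact hnat n hn
  have hvker : ⁅h, v⁆ - (-(j : K) - 2) • v ∈ LinearMap.ker (toEnd K L M e) := by
    simp only [LinearMap.mem_ker, toEnd_apply_apply]
    rw [lie_sub, leibniz_lie e h, hv, ← lie_skew, t.lie_h_e_smul K, hhu, lie_smul, neg_lie,
      smul_lie, hv]
    module
  obtain ⟨⟨z, hz⟩, hzv⟩ := hsurj ⟨_, hvker⟩
  replace hzv : ⁅h, z⁆ - (-(j : K) - 2) • z = ⁅h, v⁆ - (-(j : K) - 2) • v := by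
    simpa using congrArg Subtype.val hzv
  simp only [LinearMap.mem_ker, toEnd_apply_apply] at hz
  have hvz : v - z = 0 := by
    refine t.eq_zero_of_lie_f_lie_e_eq_zero (K := K) (μ := -(j : K) - 2) ?_ hnat ?_
    · rw [lie_sub, smul_sub, sub_eq_sub_iff_sub_eq_sub, hzv]
    · rw [lie_sub, hz, hv, sub_zero, hfu]
  apply hu0
  rw [← hv, sub_eq_zero.mp hvz, hz]

lemma range_toEnd_e_sup_ker_toEnd_f (t : IsSl2Triple h e f) :
    LinearMap.range (toEnd K L M e) ⊔ LinearMap.ker (toEnd K L M f) = ⊤ := by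
  have h1 := Submodule.finrank_sup_add_finrank_inf_eq
    (LinearMap.range (toEnd K L M e)) (LinearMap.ker (toEnd K L M f))
  have h2 := Submodule.finrank_sup_add_finrank_inf_eq
    (LinearMap.range (toEnd K L M f)) (LinearMap.ker (toEnd K L M e))
  rw [t.range_toEnd_e_inf_ker_toEnd_f, finrank_bot] at h1
  rw [t.symm.range_toEnd_e_inf_ker_toEnd_f, finrank_bot] at h2
  have h3 := (toEnd K L M e).finrank_range_add_finrank_ker
  have h4 := (toEnd K L M f).finrank_range_add_finrank_ker
  have h5 := Submodule.finrank_le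
    (LinearMap.range (toEnd K L M f) ⊔ LinearMap.ker (toEnd K L M e))
  exact Submodule.eq_top_of_finrank_eq
    (le_antisymm (Submodule.finrank_le _) (by omega))

lemma iSup_int_eigenspace_eq_top (t : IsSl2Triple h e f) :
    ⨆ i : ℤ, (toEnd K L M h).eigenspace (i : K) = ⊤ := by
  set S := ⨆ i : ℤ, (toEnd K L M h).eigenspace (i : K)
  have hker : LinearMap.ker (toEnd K L M e) ≤ S := t.ker_toEnd_e_le_iSup_eigenspace.trans <|
    iSup_le fun j ↦ le_iSup_of_le (j : ℤ) (by simp)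
  have hf : S ≤ S.comap (toEnd K L M f) := by
    refine iSup_le fun i x hx ↦ Submodule.mem_iSup_of_mem (i - 2) ?_
    simp only [Module.End.mem_eigenspace_iff, toEnd_apply_apply] at hx ⊢
    rw [leibniz_lie h, hx, t.lie_lie_smul_f K, neg_lie, smul_lie, lie_smul]
    push_cast
    module
  have hfpow (n : ℕ) : S ≤ S.comap (toEnd K L M f ^ n) := by
    induction n with
    | zero => simp [Module.End.one_eq_id]
    | succ n ih => exact fun x hx ↦ by rw [pow_succ']; exact hf (ih hx)
  have hpow (n : ℕ) : ⊤ ≤ S ⊔ LinearMap.range (toEnd K L M f ^ n) := by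
    induction n with
    | zero => simp [Module.End.one_eq_id]
    | succ n ih =>
      refine ih.trans (sup_le le_sup_left ?_)
      rintro _ ⟨w, rfl⟩
      have hw : w ∈ LinearMap.range (toEnd K L M f) ⊔ LinearMap.ker (toEnd K L M e) := by
        rw [t.symm.range_toEnd_e_sup_ker_toEnd_f]; trivial
      obtain ⟨_, ⟨b, rfl⟩, a, ha, rfl⟩ := Submodule.mem_sup.mp hw
      rw [map_add, sup_comm]
      exact Submodule.add_mem_sup ⟨b, by rw [pow_succ]; rfl⟩ (hfpow n (hker ha))
  obtain ⟨n, hn⟩ := t.isNilpotent_toEnd_f K M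
  simpa [hn] using hpow n

end Representation

end IsSl2Triple

section Grading

variable {L : Type*} [LieRing L] [LieAlgebra ℂ L] {e h : L}

lemma mem_gEig {i : ℤ} {x : L} : x ∈ gEig h i ↔ ⁅h, x⁆ = (i : ℂ) • x := by
  simp [gEig]

lemma gEig_le_biSup {s : Set ℤ} {i : ℤ} (hi : i ∈ s) : gEig h i ≤ ⨆ j ∈ s, gEig h j :=
  le_biSup (gEig h) hi

lemma lie_e_mem_biSup_gEig (hhe : ⁅h, e⁆ = (2 : ℂ) • e) {s t : Set ℤ}
    (hst : ∀ i ∈ s, i + 2 ∈ t) {x : L} (hx : x ∈ ⨆ i ∈ s, gEig h i) :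
    ⁅e, x⁆ ∈ ⨆ i ∈ t, gEig h i := by
  suffices ⨆ i ∈ s, gEig h i ≤ (⨆ i ∈ t, gEig h i).comap (ad ℂ L e) from this hx
  refine iSup₂_le fun i hi y hy ↦ gEig_le_biSup (hst i hi) ?_
  rw [mem_gEig] at hy
  rw [ad_apply, mem_gEig, leibniz_lie, hhe, hy, smul_lie, lie_smul]
  push_cast
  module

lemma killingForm_lie_left (x y z : L) :
    killingForm ℂ L ⁅x, y⁆ z = -killingForm ℂ L y ⁅x, z⁆ := by
  rw [← lie_skew, map_neg, LinearMap.neg_apply, LieModule.traceForm_apply_lie_apply]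

lemma killingForm_eq_zero_of_mem_gEig {i j : ℤ} (hij : i + j ≠ 0) {x y : L}
    (hx : x ∈ gEig h i) (hy : y ∈ gEig h j) : killingForm ℂ L x y = 0 := by
  rw [mem_gEig] at hx hy
  have key := killingForm_lie_left h x y
  rw [hx, hy, map_smul, LinearMap.smul_apply, map_smul, smul_eq_mul, smul_eq_mul] at key
  have hij' : (i + j : ℂ) ≠ 0 := by exact_mod_cast hij
  exact (mul_eq_zero.mp (by linear_combination key :
    (i + j : ℂ) * killingForm ℂ L x y = 0)).resolve_left hij'

lemma killingForm_eq_zero_of_mem_biSup_gEig {s t : Set ℤ} (hst : ∀ i ∈ s, ∀ j ∈ t, i + j ≠ 0)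
    {x y : L} (hx : x ∈ ⨆ i ∈ s, gEig h i) (hy : y ∈ ⨆ i ∈ t, gEig h i) :
    killingForm ℂ L x y = 0 := by
  suffices ⨆ i ∈ s, gEig h i ≤
      (⨆ i ∈ t, gEig h i).dualAnnihilator.comap (killingForm ℂ L) from
    (Submodule.mem_dualAnnihilator _).mp (this hx) y hy
  refine iSup₂_le fun i hi a ha ↦ (Submodule.mem_dualAnnihilator _).mpr fun b hb ↦ ?_
  suffices ⨆ i ∈ t, gEig h i ≤ LinearMap.ker (killingForm ℂ L a) from this hb
  exact iSup₂_le fun j hj c hc ↦ killingForm_eq_zero_of_mem_gEig (hst i hi j hj) ha hc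

lemma mem_lPerpOmega {l : Submodule ℂ L} {y : L} :
    y ∈ lPerpOmega e h l ↔ y ∈ gEig h (-1) ∧ ∀ x ∈ l, killingForm ℂ L ⁅x, y⁆ e = 0 := by
  simp [lPerpOmega]

lemma mem_mPerp {l : Submodule ℂ L} {x : L} :
    x ∈ mPerp e h l ↔ ∀ z ∈ mSub e h l, killingForm ℂ L x z = 0 := by
  simp [mPerp]

lemma killingForm_lie_e_eq (x y : L) :
    killingForm ℂ L ⁅x, y⁆ e = killingForm ℂ L x ⁅y, e⁆ :=
  LieModule.traceForm_apply_lie_apply ℂ L L x y e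

lemma mSub_le (l : Submodule ℂ L) : mSub e h l ≤ gLe h (-1) :=
  sup_le (inf_le_left.trans (gEig_le_biSup (by simp)))
    (biSup_mono fun i hi ↦ by simp only [Set.mem_Iic] at hi ⊢; omega)

lemma lie_e_mem_mPerp (hhe : ⁅h, e⁆ = (2 : ℂ) • e) {l : Submodule ℂ L}
    (hl : l ≤ gEig h (-1)) {x : L} (hx : x ∈ nSub h l) : ⁅e, x⁆ ∈ mPerp e h l := by
  rw [mem_mPerp]
  intro z hz
  obtain ⟨a, ha, b, hb, rfl⟩ := Submodule.mem_sup.mp hx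
  rw [lie_add, map_add, LinearMap.add_apply]
  have hb0 : killingForm ℂ L ⁅e, b⁆ z = 0 :=
    killingForm_eq_zero_of_mem_biSup_gEig (h := h) (s := Set.Iic 0) (t := Set.Iic (-1))
      (by simp only [Set.mem_Iic]; omega)
      (lie_e_mem_biSup_gEig hhe (by simp only [Set.mem_Iic]; omega) hb) (mSub_le l hz)
  rw [hb0, add_zero]
  obtain ⟨c, hc, d, hd, rfl⟩ := Submodule.mem_sup.mp hz
  have hd0 : killingForm ℂ L ⁅e, a⁆ d = 0 :=
    killingForm_eq_zero_of_mem_biSup_gEig (h := h) (s := {1}) (t := Set.Iic (-2))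
      (by simp only [Set.mem_Iic, Set.mem_singleton_iff]; omega)
      (lie_e_mem_biSup_gEig hhe (s := {-1}) (by simp) (gEig_le_biSup (by simp) (hl ha))) hd
  have hc0 := (mem_lPerpOmega.mp hc).2 a ha
  rw [map_add, hd0, add_zero, killingForm_lie_left, ← lie_skew, map_neg, neg_neg,
    ← killingForm_lie_e_eq, hc0]

end Grading

section Orthogonal

variable {L : Type*} [LieRing L] [LieAlgebra ℂ L]

lemma eq_zero_of_forall_killingForm_eq_zero [IsKilling ℂ L] {x : L}
    (hx : ∀ y, killingForm ℂ L x y = 0) : x = 0 := by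
  have : x ∈ LinearMap.ker (killingForm ℂ L) := LinearMap.ext hx
  simpa using this

variable [Module.Finite ℂ L]

lemma ker_ad_f_le_mPerp {e h f : L} (ht : IsSl2Triple h e f) (l : Submodule ℂ L) :
    LinearMap.ker (ad ℂ L f) ≤ mPerp e h l := by
  intro x hx
  rw [mem_mPerp]
  intro z hz
  have hle : LinearMap.ker (ad ℂ L f) ≤ ⨆ i ∈ Set.Iic (0 : ℤ), gEig h i := by
    refine ht.symm.ker_toEnd_e_le_iSup_eigenspace.trans <| iSup_le fun j y hy ↦
      gEig_le_biSup (i := -j) (by simp) ?_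
    rw [Module.End.mem_eigenspace_iff, LieModule.toEnd_apply_apply, neg_lie, neg_eq_iff_eq_neg]
      at hy
    rw [mem_gEig, hy]
    simp
  exact killingForm_eq_zero_of_mem_biSup_gEig (by simp only [Set.mem_Iic]; omega) (hle hx)
    (mSub_le l hz)

variable [IsKilling ℂ L]

lemma mem_of_forall_killingForm_eq_zero {W : Submodule ℂ L} {x : L}
    (hx : ∀ w, (∀ y ∈ W, killingForm ℂ L w y = 0) → killingForm ℂ L w x = 0) : x ∈ W := by
  have hrefl : (killingForm ℂ L).IsRefl := (LieModule.traceForm_isSymm ℂ L L).isRefl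
  rw [← LinearMap.BilinForm.orthogonal_orthogonal (IsKilling.killingForm_nondegenerate ℂ L) hrefl W,
    LinearMap.BilinForm.mem_orthogonal_iff]
  refine fun w hw ↦ hx w fun y hy ↦ hrefl _ _ ?_
  exact LinearMap.BilinForm.mem_orthogonal_iff.mp hw y hy

lemma mem_range_ad_of_forall_killingForm_eq_zero (e : L) {w : L}
    (hw : ∀ y, ⁅e, y⁆ = 0 → killingForm ℂ L w y = 0) : w ∈ LinearMap.range (ad ℂ L e) := by
  refine mem_of_forall_killingForm_eq_zero fun y hy ↦ ?_
  rw [LieModule.traceForm_comm]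
  refine hw y (eq_zero_of_forall_killingForm_eq_zero fun z ↦ ?_)
  rw [killingForm_lie_left, neg_eq_zero]
  exact hy _ ⟨z, rfl⟩

lemma mem_ker_ad_sup_nSub {e h f : L} (ht : IsSl2Triple h e f) {l : Submodule ℂ L}
    (hl : l ≤ gEig h (-1)) {x : L} (hx : ⁅e, x⁆ ∈ mPerp e h l) :
    x ∈ LinearMap.ker (ad ℂ L e) ⊔ nSub h l := by
  have hhe := ht.lie_h_e_smul ℂ
  refine mem_of_forall_killingForm_eq_zero fun w hw ↦ ?_
  obtain ⟨y, rfl⟩ := mem_range_ad_of_forall_killingForm_eq_zero e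
    fun y hy ↦ hw y (Submodule.mem_sup_left hy)
  have hwn (y) (hy : y ∈ nSub h l) := hw y (Submodule.mem_sup_right hy)
  simp only [ad_apply] at hwn ⊢
  have htop : (⨆ i ∈ Set.Ici (0 : ℤ), gEig h i) ⊔ (gEig h (-1) ⊔ gLe h (-2)) = ⊤ := by
    rw [eq_top_iff, ← ht.iSup_int_eigenspace_eq_top (K := ℂ) (M := L)]
    refine iSup_le fun i ↦ ?_
    rcases lt_trichotomy i (-1) with hi | rfl | hi
    · exact (gEig_le_biSup (s := Set.Iic (-2)) (by simp only [Set.mem_Iic]; omega)).trans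
        (le_sup_right.trans le_sup_right)
    · exact le_sup_left.trans le_sup_right
    · exact (gEig_le_biSup (by simp only [Set.mem_Ici]; omega)).trans le_sup_left
  obtain ⟨a, ha, bc, hbc, rfl⟩ := Submodule.mem_sup.mp (htop ▸ Submodule.mem_top : y ∈ _)
  obtain ⟨b, hb, c, hc, rfl⟩ := Submodule.mem_sup.mp hbc
  have heb := lie_e_mem_biSup_gEig hhe (s := {-1}) (t := {1}) (by simp)
    (gEig_le_biSup (by simp) hb)
  have hec := lie_e_mem_biSup_gEig hhe (s := Set.Iic (-2)) (t := Set.Iic 0)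
    (by simp only [Set.mem_Iic]; omega) hc
  have hea := lie_e_mem_biSup_gEig hhe (s := Set.Ici 0) (t := Set.Ici 2)
    (by simp only [Set.mem_Ici]; omega) ha
  have hea0 : ⁅e, a⁆ = 0 := by
    refine eq_zero_of_forall_killingForm_eq_zero fun z ↦ ?_
    obtain ⟨p, hp, qr, hqr, rfl⟩ := Submodule.mem_sup.mp (htop ▸ Submodule.mem_top : z ∈ _)
    obtain ⟨q, hq, r, hr, rfl⟩ := Submodule.mem_sup.mp hqr
    have hp0 := killingForm_eq_zero_of_mem_biSup_gEig
      (by simp only [Set.mem_Ici]; omega) hea hp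
    have hq0 := killingForm_eq_zero_of_mem_biSup_gEig (t := {-1})
      (by simp only [Set.mem_Ici, Set.mem_singleton_iff]; omega) hea (gEig_le_biSup (by simp) hq)
    have hbr := killingForm_eq_zero_of_mem_biSup_gEig
      (by simp only [Set.mem_Iic, Set.mem_singleton_iff]; omega) heb hr
    have hcr := killingForm_eq_zero_of_mem_biSup_gEig
      (by simp only [Set.mem_Iic]; omega) hec hr
    have hr0 := hwn r (Submodule.mem_sup_right hr)
    simpa [hp0, hq0, hbr, hcr] using hr0
  have hbl : b ∈ lPerpOmega e h l := by
    refine mem_lPerpOmega.mpr ⟨hb, fun u hu ↦ ?_⟩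
    have hcu := killingForm_eq_zero_of_mem_biSup_gEig (t := {-1})
      (by simp only [Set.mem_Iic, Set.mem_singleton_iff]; omega) hec
      (gEig_le_biSup (by simp) (hl hu))
    have hu0 := hwn u (Submodule.mem_sup_left hu)
    simp only [lie_add, hea0, zero_add, map_add, LinearMap.add_apply, hcu, add_zero] at hu0
    rw [killingForm_lie_e_eq, ← lie_skew, map_neg, LieModule.traceForm_comm, hu0, neg_zero]
  rw [lie_add, hea0, zero_add, killingForm_lie_left, LieModule.traceForm_comm,
    mem_mPerp.mp hx _ (Submodule.add_mem_sup hbl hc), neg_zero]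

end Orthogonal

/-- `𝔪_l^⊥ = ⁅𝔫_l, e⁆ ⊕ ker (ad f)`. -/
theorem stmt3 {L : Type*} [LieRing L] [LieAlgebra ℂ L]
    [Module.Finite ℂ L] [LieAlgebra.IsSemisimple ℂ L]
    (e h f : L) (he : e ≠ 0)
    (hhe : ⁅h, e⁆ = (2 : ℂ) • e) (hhf : ⁅h, f⁆ = (-2 : ℂ) • f) (hef : ⁅e, f⁆ = h)
    (l : Submodule ℂ L) (hl : l ≤ gEig h (-1))
    (hiso : ∀ x ∈ l, ∀ y ∈ l, killingForm ℂ L ⁅x, y⁆ e = 0) :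
    mPerp e h l = brackNlE e h l ⊔ LinearMap.ker ((ad ℂ L f)) ∧
    brackNlE e h l ⊓ LinearMap.ker ((ad ℂ L f)) = ⊥ := by
  have ht : IsSl2Triple h e f :=
    { h_ne_zero := by
        rintro rfl
        exact he (by simpa using hhe.symm)
      lie_e_f := hef
      lie_h_e_nsmul := by rw [hhe, ofNat_smul_eq_nsmul]
      lie_h_f_nsmul := by rw [hhf, neg_smul, ofNat_smul_eq_nsmul] }
  have hker := ker_ad_f_le_mPerp ht l
  have hbrack : brackNlE e h l ≤ mPerp e h l := by
    rintro _ ⟨x, hx, rfl⟩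
    exact neg_mem (lie_e_mem_mPerp hhe hl hx)
  refine ⟨le_antisymm (fun z hz ↦ ?_) (sup_le hbrack hker), ?_⟩
  · have hz' : z ∈ LinearMap.range (ad ℂ L e) ⊔ LinearMap.ker (ad ℂ L f) :=
      ht.range_toEnd_e_sup_ker_toEnd_f (K := ℂ) (M := L) ▸ Submodule.mem_top
    obtain ⟨_, ⟨x, rfl⟩, k, hk, rfl⟩ := Submodule.mem_sup.mp hz'
    obtain ⟨y, hy, n, hn, rfl⟩ := Submodule.mem_sup.mp <|
      mem_ker_ad_sup_nSub ht hl ((Submodule.add_mem_iff_left _ (hker hk)).mp hz)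
    refine Submodule.add_mem_sup ⟨-n, neg_mem hn, ?_⟩ hk
    rw [map_add, LinearMap.mem_ker.mp hy]
    simp
  · refine eq_bot_iff.mpr (le_trans (inf_le_inf_right _ ?_)
      (ht.range_toEnd_e_inf_ker_toEnd_f (K := ℂ) (M := L)).le)
    rintro _ ⟨x, -, rfl⟩
    exact ⟨-x, by simp⟩
end

section
/- Let x ∈ e + ker ad(f) and let u ∈ 𝔤 be a nonzero element with κ(u,w) = 0 for all w ∈ ker ad(f). Then ⁅x,u⁆ ∉ ker ad(f). -/
open Module LieModule

section GenEigenspaceProjection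

variable {K V : Type*} [Field K] [IsAlgClosed K] [AddCommGroup V] [Module K V]
  [FiniteDimensional K V]

/-- The projections onto the generalized eigenspaces of an endomorphism of a finite-dimensional
vector space over an algebraically closed field. -/
theorem exists_maxGenEigenspace_projections (T : End K V) :
    ∃ π : K → End K V,
      (∀ μ v, π μ v ∈ T.maxGenEigenspace μ) ∧
      (∀ μ, ∀ v ∈ T.maxGenEigenspace μ, π μ v = v) ∧
      (∀ μ ν, μ ≠ ν → ∀ v ∈ T.maxGenEigenspace μ, π ν v = 0) ∧
      (∀ v, ∃ s : Finset K, ∑ μ ∈ s, π μ v = v ∧ ∀ μ ∉ s, π μ v = 0) := by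
  classical
  have hint : DirectSum.IsInternal T.maxGenEigenspace :=
    DirectSum.isInternal_submodule_of_iSupIndep_of_iSup_eq_top
      T.independent_maxGenEigenspace T.iSup_maxGenEigenspace_eq_top
  let := hint.chooseDecomposition
  refine ⟨fun μ ↦ (T.maxGenEigenspace μ).subtype ∘ₗ DirectSum.component K K _ μ ∘ₗ
    (DirectSum.decomposeLinearEquiv T.maxGenEigenspace).toLinearMap, ?_, ?_, ?_, ?_⟩
  · intro μ v
    exact Subtype.prop _
  · intro μ v hv
    exact DirectSum.decompose_of_mem_same _ hv
  · intro μ ν hne v hv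
    exact DirectSum.decompose_of_mem_ne _ hv hne
  · intro v
    refine ⟨(DirectSum.decompose T.maxGenEigenspace v).support,
      DirectSum.sum_support_decompose T.maxGenEigenspace v, fun μ hμ ↦ ?_⟩
    have := DFinsupp.notMem_support_iff.mp hμ
    exact congrArg Subtype.val this

/-- Projections onto generalized eigenspaces intertwine with maps shifting the eigenvalues. -/
theorem projection_apply_of_shift {T : End K V} {π : K → End K V}
    (hself : ∀ μ, ∀ v ∈ T.maxGenEigenspace μ, π μ v = v)
    (hne : ∀ μ ν, μ ≠ ν → ∀ v ∈ T.maxGenEigenspace μ, π ν v = 0)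
    {S : End K V} {c : K}
    (hS : ∀ μ, ∀ v ∈ T.maxGenEigenspace μ, S v ∈ T.maxGenEigenspace (μ + c)) (μ : K) (v : V) :
    π (μ + c) (S v) = S (π μ v) := by
  have hv : v ∈ ⨆ μ, T.maxGenEigenspace μ := by
    rw [T.iSup_maxGenEigenspace_eq_top]; trivial
  induction hv using Submodule.iSup_induction' with
  | mem ν v hv =>
    by_cases h : ν = μ
    · subst h
      rw [hself _ _ hv, hself _ _ (hS _ _ hv)]
    · rw [hne _ _ h _ hv, map_zero, hne _ _ (by simpa using h) _ (hS _ _ hv)]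
  | zero => simp
  | add v w _ _ hv hw => simp only [map_add, hv, hw]

end GenEigenspaceProjection

section Sl2

variable {K L M : Type*} [Field K] [LieRing L] [LieAlgebra K L]
  [AddCommGroup M] [Module K M] [LieRingModule L M] [LieModule K L M]

theorem lie_pow_toEnd_sub_smul_apply {h x : L} {c : K} (hx : ⁅h, x⁆ = c • x) (a : K) (k : ℕ)
    (m : M) :
    ⁅x, ((toEnd K L M h - a • 1) ^ k) m⁆ = ((toEnd K L M h - (a + c) • 1) ^ k) ⁅x, m⁆ := by
  induction k generalizing m with
  | zero => simp
  | succ k ih =>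
    rw [pow_succ, pow_succ, Module.End.mul_apply, Module.End.mul_apply, ih]
    congr 1
    simp only [LinearMap.sub_apply, LinearMap.smul_apply, Module.End.one_apply,
      toEnd_apply_apply, lie_sub, lie_smul]
    rw [leibniz_lie h x m, hx, smul_lie, add_smul]
    abel

theorem mem_maxGenEigenspace_self_of_lie_eq_smul {h x : L} {c : K} (hx : ⁅h, x⁆ = c • x) :
    x ∈ (toEnd K L L h).maxGenEigenspace c := by
  rw [Module.End.mem_maxGenEigenspace]
  exact ⟨1, by simp [hx]⟩

theorem mem_maxGenEigenspace_neg_h {h : L} {μ : K} {m : M} :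
    m ∈ (toEnd K L M (-h)).maxGenEigenspace (-μ) ↔ m ∈ (toEnd K L M h).maxGenEigenspace μ := by
  simp only [Module.End.mem_maxGenEigenspace]
  refine exists_congr fun k ↦ ?_
  have : toEnd K L M (-h) - (-μ) • 1 = -(toEnd K L M h - μ • 1) := by
    rw [map_neg, neg_smul]; abel
  rw [this, neg_pow]
  rcases neg_one_pow_eq_or (End K M) k with hk | hk <;> simp [hk]

namespace IsSl2Triple

variable {h e f : L}

/-- A nonzero generalized `h`-eigenvector killed by `e` yields a primitive vector. -/
theorem exists_hasPrimitiveVectorWith_pow (t : IsSl2Triple h e f) {μ : K} {m : M} (hm0 : m ≠ 0)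
    (hm : m ∈ (toEnd K L M h).maxGenEigenspace μ) (hem : ⁅e, m⁆ = 0) :
    ∃ k : ℕ, HasPrimitiveVectorWith t (((toEnd K L M h - μ • 1) ^ k) m) μ := by
  rw [Module.End.mem_maxGenEigenspace] at hm
  obtain ⟨k, hk, hk'⟩ := Nat.exists_not_and_succ_of_not_zero_of_exists
    (p := fun k ↦ ((toEnd K L M h - μ • 1) ^ k) m = 0) (by simpa using hm0) hm
  refine ⟨k, hk, ?_, ?_⟩
  · rw [pow_succ', Module.End.mul_apply] at hk'
    simpa [sub_eq_zero] using hk'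
  · rw [lie_pow_toEnd_sub_smul_apply (t.lie_h_e_smul K), hem, map_zero]

variable [CharZero K] [FiniteDimensional K M]

theorem exists_nat_of_lie_e_eq_zero (t : IsSl2Triple h e f) {μ : K} {m : M} (hm0 : m ≠ 0)
    (hm : m ∈ (toEnd K L M h).maxGenEigenspace μ) (hem : ⁅e, m⁆ = 0) : ∃ n : ℕ, μ = n := by
  obtain ⟨k, hk⟩ := t.exists_hasPrimitiveVectorWith_pow hm0 hm hem
  exact hk.exists_nat

theorem exists_nat_of_lie_f_eq_zero (t : IsSl2Triple h e f) {μ : K} {m : M} (hm0 : m ≠ 0)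
    (hm : m ∈ (toEnd K L M h).maxGenEigenspace μ) (hfm : ⁅f, m⁆ = 0) : ∃ n : ℕ, μ = -n := by
  obtain ⟨n, hn⟩ := t.symm.exists_nat_of_lie_e_eq_zero hm0 (mem_maxGenEigenspace_neg_h.mpr hm) hfm
  exact ⟨n, by rw [← hn, neg_neg]⟩

/-- A primitive vector is not the image under `f` of an `h`-eigenvector. -/
theorem HasPrimitiveVectorWith.ne_lie_f {t : IsSl2Triple h e f} {m : M} {μ ν : K}
    (P : HasPrimitiveVectorWith t m μ) {w : M} (hw : ⁅h, w⁆ = ν • w) : m ≠ ⁅f, w⁆ := by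
  intro hmw
  obtain ⟨n, rfl⟩ := P.exists_nat
  have hν : ν = n + 2 := by
    have h1 := P.lie_h
    rw [hmw, leibniz_lie, hw, t.lie_lie_smul_f K, neg_lie, smul_lie, lie_smul, ← hmw,
      ← neg_smul, ← add_smul] at h1
    have := smul_left_injective K P.ne_zero h1
    linear_combination this
  subst hν
  have hef : ⁅e, ⁅f, w⁆⁆ = 0 := hmw ▸ P.lie_e
  have hh (k : ℕ) := t.lie_h_pow_toEnd_e hw k
  have hfe (k : ℕ) : ⁅f, ((toEnd K L M e) ^ (k + 1)) w⁆
      = (-((k + 1) * (n + 2 + k)) : K) • ((toEnd K L M e) ^ k) w := by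
    have key (v : M) : ⁅f, ⁅e, v⁆⁆ = ⁅e, ⁅f, v⁆⁆ - ⁅h, v⁆ := by
      rw [← t.lie_e_f, lie_lie]; abel
    induction k with
    | zero =>
      simp only [zero_add, pow_one, toEnd_apply_apply, key, hef, hw, pow_zero,
        Module.End.one_apply]
      rw [zero_sub, ← neg_smul]; congr 1; push_cast; ring
    | succ k ih =>
      rw [← lie_e_pow_toEnd_e, key, ih, lie_smul, lie_e_pow_toEnd_e, hh, ← sub_smul]
      congr 1; push_cast; ring
  have hne (k : ℕ) : ((toEnd K L M e) ^ k) w ≠ 0 := by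
    induction k with
    | zero =>
      rintro h0
      apply P.ne_zero
      rw [hmw, show w = 0 by simpa using h0, lie_zero]
    | succ k ih =>
      intro h0
      have h1 := hfe k
      rw [h0, lie_zero, eq_comm, smul_eq_zero_iff_left ih, neg_eq_zero] at h1
      have h2 : (((k + 1) * (n + 2 + k) : ℕ) : K) = 0 := by push_cast; exact h1
      rw [Nat.cast_eq_zero] at h2
      simp at h2
  have hinj : Function.Injective fun k : ℕ ↦ ((n + 2 : K) + 2 * k) := fun a b hab ↦ by
    simpa using hab
  refine Set.infinite_range_of_injective hinj
    ((toEnd K L M h).finite_hasEigenvalue.subset ?_)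
  rintro _ ⟨k, rfl⟩
  exact End.hasEigenvalue_of_hasEigenvector
    (x := ((toEnd K L M e) ^ k) w) (End.hasEigenvector_iff.mpr ⟨by simpa using hh k, hne k⟩)

/-- On generalized `h`-eigenvectors, `ker e` and `im f` meet trivially. -/
theorem lie_f_eq_zero_of_lie_e_lie_f_eq_zero (t : IsSl2Triple h e f) {ν : K} {w : M}
    (hw : w ∈ (toEnd K L M h).maxGenEigenspace ν) (hefw : ⁅e, ⁅f, w⁆⁆ = 0) : ⁅f, w⁆ = 0 := by
  by_contra hne
  have hf : ⁅h, f⁆ = (-2 : K) • f := by rw [t.lie_lie_smul_f K, neg_smul]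
  have hfw : ⁅f, w⁆ ∈ (toEnd K L M h).maxGenEigenspace (-2 + ν) :=
    lie_mem_maxGenEigenspace_toEnd (mem_maxGenEigenspace_self_of_lie_eq_smul hf) hw
  obtain ⟨k, P⟩ := t.exists_hasPrimitiveVectorWith_pow hne hfw hefw
  obtain ⟨n, hn⟩ := P.exists_nat
  have hcomm := lie_pow_toEnd_sub_smul_apply (M := M) hf ν k w
  rw [add_comm ν] at hcomm
  rw [← hcomm] at P
  refine P.ne_lie_f (w := ((toEnd K L M h - ν • 1) ^ k) w) (ν := ν) ?_ rfl
  have hmem : ((toEnd K L M h - ν • 1) ^ (k + 1)) w ∈ (toEnd K L M h).maxGenEigenspace ν := by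
    refine End.mapsTo_maxGenEigenspace_of_comm (g := (toEnd K L M h - ν • 1) ^ (k + 1)) ?_ ν hw
    exact ((Commute.refl _).sub_right ((Commute.one_right _).smul_right ν)).pow_right _
  have hzero : ⁅f, ((toEnd K L M h - ν • 1) ^ (k + 1)) w⁆ = 0 := by
    rw [lie_pow_toEnd_sub_smul_apply hf, pow_succ', Module.End.mul_apply, add_comm ν,
      ← hcomm]
    simpa [sub_eq_zero] using P.lie_h
  have h0 : ((toEnd K L M h - ν • 1) ^ (k + 1)) w = 0 := by
    by_contra hne'
    obtain ⟨p, hp⟩ := t.exists_nat_of_lie_f_eq_zero hne' hmem hzero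
    have : ((n + 2 + p : ℕ) : K) = 0 := by
      push_cast
      linear_combination hp - hn
    rw [Nat.cast_eq_zero] at this
    lia
  rw [pow_succ', Module.End.mul_apply] at h0
  simpa [sub_eq_zero] using h0

/-- On generalized `h`-eigenvectors, `f e f` has the same kernel as `f`. -/
theorem lie_f_eq_zero_of_lie_f_lie_e_lie_f_eq_zero (t : IsSl2Triple h e f) {ν : K} {w : M}
    (hw : w ∈ (toEnd K L M h).maxGenEigenspace ν) (hfef : ⁅f, ⁅e, ⁅f, w⁆⁆⁆ = 0) :
    ⁅f, w⁆ = 0 := by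
  refine t.lie_f_eq_zero_of_lie_e_lie_f_eq_zero hw ?_
  have hf : ⁅h, f⁆ = (-2 : K) • f := by rw [t.lie_lie_smul_f K, neg_smul]
  have hfw : ⁅f, w⁆ ∈ (toEnd K L M h).maxGenEigenspace (-2 + ν) :=
    lie_mem_maxGenEigenspace_toEnd (mem_maxGenEigenspace_self_of_lie_eq_smul hf) hw
  exact t.symm.lie_f_eq_zero_of_lie_e_lie_f_eq_zero (mem_maxGenEigenspace_neg_h.mpr hfw) hfef

end IsSl2Triple

end Sl2

/-- The orthogonal complement of `ker (ad f)` for the Killing form is the range of `ad f`. -/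
theorem exists_lie_eq_of_killingForm_eq_zero {K L : Type*} [Field K] [LieRing L] [LieAlgebra K L]
    [FiniteDimensional K L] [LieAlgebra.IsKilling K L] {f u : L}
    (hu : ∀ w : L, ⁅f, w⁆ = 0 → killingForm K L u w = 0) : ∃ v : L, u = ⁅f, v⁆ := by
  have hnd := LieAlgebra.IsKilling.killingForm_nondegenerate K L
  have hrefl : (killingForm K L).IsRefl := (traceForm_isSymm K L L).isRefl
  suffices u ∈ LinearMap.range (LieAlgebra.ad K L f) by
    obtain ⟨v, hv⟩ := this
    exact ⟨v, by simpa using hv.symm⟩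
  rw [← LinearMap.BilinForm.orthogonal_orthogonal hnd hrefl (LieAlgebra.ad K L f).range]
  intro w hw
  refine hrefl _ _ (hu w ?_)
  refine hnd.2 _ fun z ↦ ?_
  have h1 : killingForm K L ⁅z, f⁆ w = 0 := by
    rw [← lie_skew, map_neg, LinearMap.neg_apply, neg_eq_zero]
    exact hw _ ⟨z, by simp⟩
  rw [← h1]
  exact (traceForm_apply_lie_apply K L L z f w).symm


/-- If `x ∈ e + ker (ad f)` and `u ≠ 0` is `κ`-orthogonal to `ker (ad f)`,
then `⁅x, u⁆ ∉ ker (ad f)`. -/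
theorem stmt6 {L : Type*} [LieRing L] [LieAlgebra ℂ L]
    [Module.Finite ℂ L] [LieAlgebra.IsSemisimple ℂ L]
    (e h f : L) (he : e ≠ 0)
    (hhe : ⁅h, e⁆ = (2 : ℂ) • e) (hhf : ⁅h, f⁆ = (-2 : ℂ) • f) (hef : ⁅e, f⁆ = h)
    (x u : L) (hx : ∃ y : L, ⁅f, y⁆ = 0 ∧ x = e + y)
    (hu : u ≠ 0) (huperp : ∀ w : L, ⁅f, w⁆ = 0 → killingForm ℂ L u w = 0) :
    ⁅f, ⁅x, u⁆⁆ ≠ 0 := by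
  intro hfxu
  obtain ⟨y, hfy, rfl⟩ := hx
  have t : IsSl2Triple h e f :=
    { h_ne_zero := by
        rintro rfl
        rw [zero_lie, eq_comm, smul_eq_zero_iff_right two_ne_zero] at hhe
        exact he hhe
      lie_e_f := hef
      lie_h_e_nsmul := by rw [hhe, two_smul, two_nsmul]
      lie_h_f_nsmul := by rw [hhf, neg_smul, two_smul, two_nsmul] }
  obtain ⟨v, rfl⟩ := exists_lie_eq_of_killingForm_eq_zero huperp
  obtain ⟨π, hmem, hself, hne, hsum⟩ := exists_maxGenEigenspace_projections (toEnd ℂ L L h)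
  have hshift {c : ℂ} {a : L} (ha : a ∈ (toEnd ℂ L L h).maxGenEigenspace c) (μ : ℂ) (m : L) :
      π (μ + c) ⁅a, m⁆ = ⁅a, π μ m⁆ := by
    refine projection_apply_of_shift hself hne (S := toEnd ℂ L L a) (fun ν m hm ↦ ?_) μ m
    rw [add_comm]
    exact lie_mem_maxGenEigenspace_toEnd ha hm
  have hf := hshift (mem_maxGenEigenspace_self_of_lie_eq_smul hhf)
  have he := hshift (mem_maxGenEigenspace_self_of_lie_eq_smul hhe)
  set u := ⁅f, v⁆ with hu_def
  -- choose a weight of `u` whose real part is maximal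
  obtain ⟨μ, hμ, hmax⟩ : ∃ μ, π μ u ≠ 0 ∧ ∀ ν, μ.re < ν.re → π ν u = 0 := by
    classical
    obtain ⟨s, hs, hs'⟩ := hsum u
    have hne : (s.filter fun ν ↦ π ν u ≠ 0).Nonempty := by
      by_contra hempty
      rw [Finset.not_nonempty_iff_eq_empty, Finset.filter_eq_empty_iff] at hempty
      exact hu (hs ▸ Finset.sum_eq_zero fun ν hν ↦ not_not.mp (hempty hν))
    obtain ⟨μ, hμ, hmax⟩ := Finset.exists_max_image _ Complex.re hne
    refine ⟨μ, (Finset.mem_filter.mp hμ).2, fun ν hν ↦ ?_⟩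
    by_contra hν0
    refine (hmax ν (Finset.mem_filter.mpr ⟨?_, hν0⟩)).not_gt hν
    by_contra hνs
    exact hν0 (hs' ν hνs)
  have hy : π μ ⁅f, ⁅y, u⁆⁆ = 0 := by
    obtain ⟨s, hs, -⟩ := hsum y
    rw [← hs, sum_lie, lie_sum, map_sum]
    refine Finset.sum_eq_zero fun ν _ ↦ ?_
    by_cases hν : π ν y = 0
    · simp [hν]
    obtain ⟨n, rfl⟩ := t.exists_nat_of_lie_f_eq_zero hν (hmem ν y) (by rw [← hf, hfy, map_zero])
    have h1 := hf (μ + 2) ⁅π (-n) y, u⁆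
    have h2 := hshift (hmem (-n) y) (μ + 2 + n) u
    rw [add_neg_cancel_right] at h1 h2
    rw [h1, h2, hmax, lie_zero, lie_zero]
    simp only [Complex.add_re, Complex.re_ofNat, Complex.natCast_re]
    linarith [n.cast_nonneg (α := ℝ)]
  have hfe : ⁅f, ⁅e, π μ u⁆⁆ = 0 := by
    rw [← he, ← hf, add_neg_cancel_right]
    simpa [hy] using congrArg (π μ) hfxu
  have hμu : π μ u = ⁅f, π (μ + 2) v⁆ := by
    rw [← hf, add_neg_cancel_right]
  rw [hμu] at hfe hμ
  exact hμ (t.lie_f_eq_zero_of_lie_f_lie_e_lie_f_eq_zero (hmem _ _) hfe)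
end

section
/- If α ∈ S, β ∈ R satisfies 𝔤_β ⊆ D_k(𝔫), and i, j are positive integers such that iα + jβ ∈ R, then 𝔤_{iα+jβ} ⊆ D_{k+1}(𝔫). -/
open LieAlgebra

namespace LieAlgebra.IsKilling

open LieModule Module

variable {K L : Type*} [Field K] [CharZero K] [LieRing L] [LieAlgebra K L]
  [IsKilling K L] [FiniteDimensional K L]
  {H : LieSubalgebra K L} [H.IsCartanSubalgebra] [IsTriangularizable K H L]

/-- If `α`, `β` and `γ = α + β` are weights with `α`, `γ` nonzero, then some bracket of elements of
the root spaces of `α` and `β` is nonzero. -/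
lemma exists_lie_ne_zero_of_eq_add {α β γ : Weight K H L} (hα : α.IsNonZero)
    (h : (γ : H → K) = α + β) :
    ∃ x ∈ rootSpace H α, ∃ y ∈ rootSpace H β, ⁅x, y⁆ ≠ 0 := by
  obtain ⟨t, ht⟩ : ∃ t, chainTopCoeff α β = t + 1 := by
    have h₁ := ((rootSpace_zsmul_add_ne_bot_iff α β hα 1).mp
      (by simpa [← h] using! γ.genWeightSpace_ne_bot)).1
    exact ⟨chainTopCoeff α β - 1, by lia⟩
  obtain ⟨v, hv, hv₀⟩ := (chainTop α β).exists_ne_zero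
  obtain ⟨_, e, f, isSl2, he, hf⟩ := exists_isSl2Triple_of_weight_isNonZero hα
  obtain rfl := isSl2.h_eq_coroot hα he hf
  have prim : isSl2.HasPrimitiveVectorWith v (chainLength α β : K) :=
    have := lie_mem_genWeightSpace_of_mem_genWeightSpace he hv
    ⟨hv₀, (chainLength_smul _ _ hv).symm, by rwa [genWeightSpace_add_chainTop _ _ hα] at this⟩
  have hle : t + 1 ≤ chainLength α β := ht ▸ chainTopCoeff_le_chainLength α β
  refine ⟨e, he, (toEnd K L L f ^ (t + 1)) v, ?_, ?_⟩
  · have := toEnd_pow_apply_mem hf hv (t + 1)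
    rwa [coe_chainTop', ht, smul_neg, neg_add_cancel_left] at this
  · rw [prim.lie_e_pow_succ_toEnd_f]
    refine smul_ne_zero (mul_ne_zero t.cast_add_one_ne_zero (sub_ne_zero.mpr ?_))
      (prim.pow_toEnd_f_ne_zero_of_eq_nat rfl (by lia))
    exact_mod_cast (by lia : chainLength α β ≠ t)

lemma rootSpace_le_of_forall_lie_mem {α β γ : Weight K H L} (hα : α.IsNonZero) (hγ : γ.IsNonZero)
    (h : (γ : H → K) = α + β) {V : Submodule K L}
    (hV : ∀ x ∈ rootSpace H α, ∀ y ∈ rootSpace H β, ⁅x, y⁆ ∈ V) :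
    (rootSpace H γ).toSubmodule ≤ V := by
  obtain ⟨x, hx, y, hy, hxy⟩ := exists_lie_ne_zero_of_eq_add hα h
  have hmem : ⁅x, y⁆ ∈ rootSpace H γ := h ▸ lie_mem_genWeightSpace_of_mem_genWeightSpace hx hy
  intro z hz
  obtain ⟨c, hc⟩ := (finrank_eq_one_iff_of_nonzero' (⟨_, hmem⟩ : rootSpace H γ)
    (by simpa [Subtype.ext_iff] using hxy)).mp (finrank_rootSpace_eq_one _ hγ) ⟨z, hz⟩
  obtain rfl : c • ⁅x, y⁆ = z := congr_arg Subtype.val hc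
  exact V.smul_mem c (hV x hx y hy)

lemma natCast_smul_add_natCast_smul_ne_zero {α β : Weight K H L} (hα : α.IsNonZero)
    (hβ : β.IsNonZero) (hαβ : (β : H → K) ≠ -α) {p q : ℕ} (hpq : p + q ≠ 0) :
    (p : K) • (α : H → K) + (q : K) • (β : H → K) ≠ 0 := by
  intro h
  have hα' : (α : H → K) ≠ 0 := hα
  rcases eq_or_ne q 0 with rfl | hq
  · simp_all
  have hq' : (q : K) ≠ 0 := by exact_mod_cast hq
  have hβα : (β : H → K) = (-(q : K)⁻¹ * p) • (α : H → K) := by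
    rw [mul_smul, eq_neg_of_add_eq_zero_left h, smul_neg, neg_smul, neg_neg, inv_smul_smul₀ hq']
  rcases eq_neg_or_eq_of_eq_smul α β hβ _ hβα with rfl | rfl
  · exact hαβ rfl
  · rw [← add_smul, smul_eq_zero_iff_left hα'] at h
    exact hpq (by exact_mod_cast h)

lemma eq_of_eq_natCast_smul {α β : Weight K H L} (hβ : β.IsNonZero) {n : ℕ}
    (h : (β : H → K) = (n : K) • (α : H → K)) : β = α := by
  refine (eq_neg_or_eq_of_eq_smul α β hβ _ h).resolve_left ?_
  rintro rfl
  have h' : ((n + 1 : ℕ) : K) • (α : H → K) = 0 := by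
    rw [Nat.cast_succ, add_smul, ← h]; simp
  have hα : (α : H → K) ≠ 0 := Weight.isNonZero_neg.mp hβ
  rw [smul_eq_zero_iff_left hα] at h'
  exact n.succ_ne_zero (by exact_mod_cast h')

lemma exists_weight_eq_sub {α γ : Weight K H L} (hγ : γ.IsNonZero) {a : ℤ}
    (ha : α (coroot γ) = a) (hpos : 0 < a) :
    ∃ δ : Weight K H L, (δ : H → K) = γ - α := by
  have hb : 1 ≤ (chainBotCoeff γ α : ℤ) := by
    have := ha.symm.trans (apply_coroot_eq_cast γ α)
    norm_cast at this
    lia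
  have hne := (rootSpace_zsmul_add_ne_bot_iff γ α hγ (-1)).mpr ⟨by lia, by lia⟩
  exact ⟨-⟨_, hne⟩, by simp [Weight.coe_neg, sub_eq_add_neg, add_comm]⟩

/-- If `N` contains the root spaces of `α` and `β`, if `V` contains the root space of `β`, and if
`V' ≤ V` contains all brackets `⁅N, V⁆`, then `V'` contains the root space of every root
`i • α + j • β` with `i` and `j` positive. -/
lemma rootSpace_le_of_eq_natCast_smul_add {α β : Weight K H L} (hα : α.IsNonZero)
    (hβ : β.IsNonZero) (hαβ : (β : H → K) ≠ -α) {N V V' : Submodule K L}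
    (hαN : (rootSpace H α).toSubmodule ≤ N) (hβN : (rootSpace H β).toSubmodule ≤ N)
    (hβV : (rootSpace H β).toSubmodule ≤ V) (hV : V' ≤ V)
    (hlie : ∀ x ∈ N, ∀ y ∈ V, ⁅x, y⁆ ∈ V') {i j : ℕ} (hi : 0 < i) (hj : 0 < j)
    {γ : Weight K H L} (hγ : γ.IsNonZero)
    (h : (γ : H → K) = (i : K) • (α : H → K) + (j : K) • (β : H → K)) :
    (rootSpace H γ).toSubmodule ≤ V' := by
  induction hn : i + j generalizing i j γ with
  | zero => lia
  | succ n ih =>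
    obtain ⟨a, ha⟩ : ∃ a : ℤ, α (coroot γ) = a := ⟨_, apply_coroot_eq_cast γ α⟩
    obtain ⟨b, hb⟩ : ∃ b : ℤ, β (coroot γ) = b := ⟨_, apply_coroot_eq_cast γ β⟩
    have hsum : (i : ℤ) * a + j * b = 2 := by
      have := root_apply_coroot hγ
      rw [h] at this
      simp only [Pi.add_apply, Pi.smul_apply, smul_eq_mul, ha, hb] at this
      exact_mod_cast this
    have hab : 0 < a ∨ 0 < b := by
      by_contra! hab
      nlinarith [mul_nonneg i.cast_nonneg (neg_nonneg.mpr hab.1),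
        mul_nonneg j.cast_nonneg (neg_nonneg.mpr hab.2)]
    obtain ⟨i, rfl⟩ := Nat.exists_eq_add_of_lt hi
    obtain ⟨j, rfl⟩ := Nat.exists_eq_add_of_lt hj
    simp only [zero_add] at *
    rcases hab with hpos | hpos
    · obtain ⟨δ, hδ⟩ := exists_weight_eq_sub hγ ha hpos
      have hδ' : (δ : H → K) = (i : K) • (α : H → K) + ((j + 1 : ℕ) : K) • (β : H → K) := by
        rw [hδ, h, Nat.cast_succ i, add_smul]; module
      have hδ₀ : δ.IsNonZero := fun h₀ ↦
        natCast_smul_add_natCast_smul_ne_zero hα hβ hαβ (by lia) (hδ'.symm.trans h₀)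
      have hδV : (rootSpace H δ).toSubmodule ≤ V := by
        rcases i.eq_zero_or_pos with rfl | hi'
        · obtain rfl : δ = β := eq_of_eq_natCast_smul (n := j + 1) hδ₀ (by simpa using hδ')
          exact hβV
        · exact (ih hi' hj hδ₀ hδ' (by lia)).trans hV
      exact rootSpace_le_of_forall_lie_mem hα hγ (by rw [hδ]; abel)
        fun x hx y hy ↦ hlie x (hαN hx) y (hδV hy)
    · obtain ⟨δ, hδ⟩ := exists_weight_eq_sub hγ hb hpos
      have hδ' : (δ : H → K) = ((i + 1 : ℕ) : K) • (α : H → K) + (j : K) • (β : H → K) := by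
        rw [hδ, h, Nat.cast_succ j, add_smul]; module
      have hδ₀ : δ.IsNonZero := fun h₀ ↦
        natCast_smul_add_natCast_smul_ne_zero hα hβ hαβ (by lia) (hδ'.symm.trans h₀)
      rcases j.eq_zero_or_pos with rfl | hj'
      · obtain rfl : δ = α := eq_of_eq_natCast_smul (n := i + 1) hδ₀ (by simpa using hδ')
        exact rootSpace_le_of_forall_lie_mem hα hγ (by rw [hδ]; abel)
          fun x hx y hy ↦ hlie x (hαN hx) y (hβV hy)
      · have hδV := (ih hi hj' hδ₀ hδ' (by lia)).trans hV
        exact rootSpace_le_of_forall_lie_mem hβ hγ (by rw [hδ]; abel)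
          fun x hx y hy ↦ hlie x (hβN hx) y (hδV hy)

end LieAlgebra.IsKilling

lemma LieAlgebra.mem_of_rootSpace_le_biSup {K L : Type*} [Field K] [LieRing L] [LieAlgebra K L]
    {H : LieSubalgebra K L} [LieRing.IsNilpotent H] {S : Set (H → K)} {β : H → K}
    (hβ : rootSpace H β ≠ ⊥)
    (h : (rootSpace H β).toSubmodule ≤ ⨆ α ∈ S, (rootSpace H α).toSubmodule) : β ∈ S := by
  by_contra hS
  have hind := LieSubmodule.iSupIndep_toSubmodule.mpr (LieModule.iSupIndep_genWeightSpace K H L)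
  have hdisj := (hind β).mono_right
    (iSup₂_mono' fun α (hα : α ∈ S) ↦ ⟨α, ne_of_mem_of_not_mem hα hS, le_rfl⟩)
  exact hβ ((LieSubmodule.toSubmodule_eq_bot _).mp (disjoint_self.mp (hdisj.mono_right h)))

/-- Let `𝔫 = ⊕_{α ∈ S} 𝔤_α` be a subalgebra that is a direct sum of root
spaces, with `S ∩ (-S) = ∅`, and let `D₀(𝔫) = 𝔫`, `D_{k+1}(𝔫) = ⁅𝔫, D_k(𝔫)⁆`.  If `α ∈ S`,
`β` is a root with `𝔤_β ⊆ D_k(𝔫)`, and `i, j > 0` are such that `iα + jβ` is a root, then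
`𝔤_{iα+jβ} ⊆ D_{k+1}(𝔫)`. -/
theorem stmt15 {L : Type*} [LieRing L] [LieAlgebra ℂ L]
    [Module.Finite ℂ L] [LieAlgebra.IsSemisimple ℂ L]
    (H : LieSubalgebra ℂ L) [H.IsCartanSubalgebra]
    (S : Set (H → ℂ))
    (hSroot : ∀ α ∈ S, α ≠ 0 ∧ rootSpace H α ≠ ⊥)
    (hSneg : ∀ α ∈ S, -α ∉ S)
    (N : LieSubalgebra ℂ L)
    (hN : N.toSubmodule = ⨆ α ∈ S, (rootSpace H α : Submodule ℂ L))
    (D : ℕ → Submodule ℂ L)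
    (hD0 : D 0 = N.toSubmodule)
    (hDsucc : ∀ k : ℕ,
      D (k + 1) = Submodule.span ℂ {z : L | ∃ x ∈ N, ∃ y ∈ D k, z = ⁅x, y⁆}) :
    ∀ α ∈ S, ∀ β : H → ℂ, β ≠ 0 → rootSpace H β ≠ ⊥ →
      ∀ k : ℕ, (rootSpace H β : Submodule ℂ L) ≤ D k →
        ∀ i j : ℕ, 0 < i → 0 < j →
          (i : ℂ) • α + (j : ℂ) • β ≠ 0 →
          rootSpace H ((i : ℂ) • α + (j : ℂ) • β) ≠ ⊥ →
          (rootSpace H ((i : ℂ) • α + (j : ℂ) • β) : Submodule ℂ L) ≤ D (k + 1) := by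
  intro α hα β hβ₀ hβ k hβk i j hi hj hγ₀ hγ
  have hlie : ∀ k, ∀ x ∈ N, ∀ y ∈ D k, ⁅x, y⁆ ∈ D (k + 1) := fun k x hx y hy ↦
    hDsucc k ▸ Submodule.subset_span ⟨x, hx, y, hy, rfl⟩
  have hanti : Antitone D := by
    refine antitone_nat_of_succ_le fun k ↦ ?_
    induction k with
    | zero =>
      rw [hDsucc, Submodule.span_le]
      rintro _ ⟨x, hx, y, hy, rfl⟩
      rw [hD0] at hy ⊢
      exact N.lie_mem hx hy
    | succ k ih =>
      rw [hDsucc (k + 1), Submodule.span_le]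
      rintro _ ⟨x, hx, y, hy, rfl⟩
      exact hlie k x hx y (ih hy)
  have hle : ∀ δ ∈ S, (rootSpace H δ).toSubmodule ≤ N.toSubmodule := fun δ hδ ↦
    hN ▸ le_biSup (fun α : H → ℂ ↦ (rootSpace H α).toSubmodule) hδ
  have hβN : (rootSpace H β).toSubmodule ≤ N.toSubmodule :=
    hβk.trans ((hanti k.zero_le).trans hD0.le)
  have hβS : β ∈ S := mem_of_rootSpace_le_biSup hβ (hN ▸ hβN)
  exact IsKilling.rootSpace_le_of_eq_natCast_smul_add
    (α := ⟨α, (hSroot α hα).2⟩) (β := ⟨β, hβ⟩) (γ := ⟨_, hγ⟩) (hSroot α hα).1 hβ₀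
    (fun h ↦ hSneg α hα (h ▸ hβS)) (hle α hα) hβN hβk (hanti k.le_succ) (hlie k) hi hj hγ₀ rfl
end
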